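/- arXiv:1001.2942 — 4 statements merged into one kernel-verified Lean document; each statement's English description precedes it below -/
import Mathlib

section
/- For every n ≥ 6 and every c = (c_0,…,c_{n−1}) ∈ F_2^n with c_{n−1} = 0, f̂_1^n(c) = 2·( f̂_1^{n−2}(c^{n−2}) + (−1)^{c_{n−2}} · f̂_1^{n−3}(c^{n−3}) ), where c^m denotes the vector of the first m coordinates of c. -/
/-- Dot product on `F_2^n`. -/
def dotp (n : ℕ) (c x : Fin n → ZMod 2) : ZMod 2 := ∑ i, c i * x i

/-- Fourier transform of a Boolean function `f : F_2^n → F_2` at `c ∈ F_2^n`. -/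
def walsh (n : ℕ) (f : (Fin n → ZMod 2) → ZMod 2) (c : Fin n → ZMod 2) : ℤ :=
  ∑ x : Fin n → ZMod 2, (-1 : ℤ) ^ (f x + dotp n c x).val

/-- The rotation symmetric function `F_3^n(x) = Σ_i x_i x_{i+1 mod n} x_{i+2 mod n}`. -/
def F3 (n : ℕ) (x : Fin n → ZMod 2) : ZMod 2 :=
  ∑ i : Fin n, x i * x ⟨(i.val + 1) % n, Nat.mod_lt _ i.pos⟩
    * x ⟨(i.val + 2) % n, Nat.mod_lt _ i.pos⟩

/-- `t_m(x) = Σ_{i=0}^{m-3} x_i x_{i+1} x_{i+2}`. -/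
def tm (m : ℕ) (x : Fin m → ZMod 2) : ZMod 2 :=
  ∑ i ∈ Finset.range m,
    if h : i + 2 < m then x ⟨i, by omega⟩ * x ⟨i + 1, by omega⟩ * x ⟨i + 2, by omega⟩ else 0

/-- `f_0^m = t_m`. -/
def f0 (m : ℕ) (x : Fin m → ZMod 2) : ZMod 2 := tm m x

/-- `f_1^m = t_m + x_0 x_1`. -/
def f1 (m : ℕ) (x : Fin m → ZMod 2) : ZMod 2 :=
  if h : 2 ≤ m then tm m x + x ⟨0, by omega⟩ * x ⟨1, by omega⟩ else 0

/-- `f_2^m = t_m + x_{m-2} x_{m-1}`. -/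
def f2 (m : ℕ) (x : Fin m → ZMod 2) : ZMod 2 :=
  if h : 2 ≤ m then tm m x + x ⟨m - 2, by omega⟩ * x ⟨m - 1, by omega⟩ else 0

/-- `f_3^m = t_m + x_0 x_1 + x_{m-2} x_{m-1} + x_0 + x_{m-1}`. -/
def f3 (m : ℕ) (x : Fin m → ZMod 2) : ZMod 2 :=
  if h : 2 ≤ m then
    tm m x + x ⟨0, by omega⟩ * x ⟨1, by omega⟩ + x ⟨m - 2, by omega⟩ * x ⟨m - 1, by omega⟩
      + x ⟨0, by omega⟩ + x ⟨m - 1, by omega⟩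
  else 0

/-- `c^m`: the vector of the first `m` coordinates of `c ∈ F_2^n`. -/
def trunc {n : ℕ} (m : ℕ) (h : m ≤ n) (c : Fin n → ZMod 2) : Fin m → ZMod 2 :=
  fun i => c (Fin.castLE h i)

/-- `e_1 = (1,0,…,0) ∈ F_2^m`. -/
def eOne (m : ℕ) : Fin m → ZMod 2 := fun i => if i.val = 0 then 1 else 0

/-- `e_{2^{m-1}} = (0,…,0,1) ∈ F_2^m`. -/
def eLast (m : ℕ) : Fin m → ZMod 2 := fun i => if i.val = m - 1 then 1 else 0

/-- The weight of a Boolean function: the number of `x` with `f x = 1`. -/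
def wt (n : ℕ) (f : (Fin n → ZMod 2) → ZMod 2) : ℕ :=
  (Finset.univ.filter fun x => f x = 1).card

theorem sum_fin_snoc {M : Type*} [AddCommMonoid M] (m : ℕ)
    (F : (Fin (m + 1) → ZMod 2) → M) :
    ∑ x, F x = ∑ y : Fin m → ZMod 2, ∑ a : ZMod 2, F (Fin.snoc y a) := by
  rw [← (Fin.snocEquiv fun _ : Fin (m + 1) => ZMod 2).sum_comp, Fintype.sum_prod_type,
    Finset.sum_comm]
  rfl

theorem dotp_snoc (m : ℕ) (c : Fin (m + 1) → ZMod 2) (y : Fin m → ZMod 2) (a : ZMod 2) :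
    dotp (m + 1) c (Fin.snoc y a : Fin (m + 1) → ZMod 2)
      = dotp m (fun i => c i.castSucc) y + c (Fin.last m) * a := by
  simp [dotp, Fin.sum_univ_castSucc]

theorem fin_snoc_mk_of_lt {m i : ℕ} (y : Fin m → ZMod 2) (a : ZMod 2) (h : i < m)
    (h' : i < m + 1) :
    (Fin.snoc y a : Fin (m + 1) → ZMod 2) ⟨i, h'⟩ = y ⟨i, h⟩ :=
  Fin.snoc_castSucc (α := fun _ => ZMod 2) a y ⟨i, h⟩

theorem fin_snoc_mk_self {m : ℕ} (y : Fin m → ZMod 2) (a : ZMod 2) (h : m < m + 1) :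
    (Fin.snoc y a : Fin (m + 1) → ZMod 2) ⟨m, h⟩ = a :=
  Fin.snoc_last (α := fun _ => ZMod 2) a y

theorem tm_snoc (m : ℕ) (y : Fin (m + 2) → ZMod 2) (a : ZMod 2) :
    tm (m + 3) (Fin.snoc y a : Fin (m + 3) → ZMod 2)
      = tm (m + 2) y + y ⟨m, by omega⟩ * y ⟨m + 1, by omega⟩ * a := by
  unfold tm
  rw [Finset.sum_range_succ, Finset.sum_range_succ, Finset.sum_range_succ,
    Finset.sum_range_succ, Finset.sum_range_succ,
    dif_neg (show ¬m + 2 + 2 < m + 3 by omega), dif_neg (show ¬m + 1 + 2 < m + 3 by omega),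
    dif_neg (show ¬m + 1 + 2 < m + 2 by omega), dif_neg (show ¬m + 2 < m + 2 by omega),
    dif_pos (show m + 2 < m + 3 by omega),
    fin_snoc_mk_of_lt y a (by omega), fin_snoc_mk_of_lt y a (by omega),
    fin_snoc_mk_self y a]
  simp only [add_zero]
  congr 1
  refine Finset.sum_congr rfl fun i hi => ?_
  have hi := Finset.mem_range.1 hi
  rw [dif_pos (by omega), dif_pos (by omega), fin_snoc_mk_of_lt y a (by omega),
    fin_snoc_mk_of_lt y a (by omega), fin_snoc_mk_of_lt y a (by omega)]

theorem f1_snoc (m : ℕ) (y : Fin (m + 2) → ZMod 2) (a : ZMod 2) :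
    f1 (m + 3) (Fin.snoc y a : Fin (m + 3) → ZMod 2)
      = f1 (m + 2) y + y ⟨m, by omega⟩ * y ⟨m + 1, by omega⟩ * a := by
  unfold f1
  rw [dif_pos (by omega), dif_pos (by omega), tm_snoc, fin_snoc_mk_of_lt y a (by omega),
    fin_snoc_mk_of_lt y a (by omega)]
  ring

theorem sum_neg_one_pow_val (A u v w r s : ZMod 2) :
    ∑ p : ZMod 2, ∑ q : ZMod 2, ∑ a : ZMod 2,
        (-1 : ℤ) ^ (A + u * v * p + v * p * q + p * q * a + (w + r * p + s * q + 0 * a)).val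
      = 2 * (∑ p : ZMod 2, (-1 : ℤ) ^ (A + u * v * p + (w + r * p)).val
          + (-1 : ℤ) ^ s.val * (-1 : ℤ) ^ (A + w).val) := by
  revert A u v w r s
  decide

/-- For every `n ≥ 6` and `c ∈ F_2^n` with `c_{n−1} = 0`,
`f̂_1^n(c) = 2(f̂_1^{n−2}(c^{n−2}) + (−1)^{c_{n−2}} f̂_1^{n−3}(c^{n−3}))`. -/
theorem stmt_7 (n : ℕ) (hn : 6 ≤ n) (c : Fin n → ZMod 2)
    (hc : c ⟨n - 1, by omega⟩ = 0) :
    walsh n (f1 n) c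
      = 2 * (walsh (n - 2) (f1 (n - 2)) (trunc (n - 2) (by omega) c)
          + (-1 : ℤ) ^ (c ⟨n - 2, by omega⟩).val
              * walsh (n - 3) (f1 (n - 3)) (trunc (n - 3) (by omega) c)) := by
  obtain ⟨j, rfl⟩ : ∃ j, n = j + 5 := ⟨n - 5, by omega⟩
  change c (Fin.last (j + 4)) = 0 at hc
  change walsh (j + 5) (f1 (j + 5)) c
      = 2 * (walsh (j + 3) (f1 (j + 3)) (fun i => c i.castSucc.castSucc)
          + (-1 : ℤ) ^ (c (Fin.last (j + 3)).castSucc).val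
              * walsh (j + 2) (f1 (j + 2)) (fun i => c i.castSucc.castSucc.castSucc))
  unfold walsh
  rw [sum_fin_snoc, sum_fin_snoc, sum_fin_snoc, sum_fin_snoc (j + 2), Finset.mul_sum,
    ← Finset.sum_add_distrib, Finset.mul_sum]
  refine Finset.sum_congr rfl fun z _ => ?_
  simp only [f1_snoc, dotp_snoc, hc]
  rw [← sum_neg_one_pow_val]
  refine Finset.sum_congr rfl fun p _ => Finset.sum_congr rfl fun q _ =>
    Finset.sum_congr rfl fun a _ => ?_
  rw [fin_snoc_mk_of_lt z p (by omega), fin_snoc_mk_self z p,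
    fin_snoc_mk_of_lt _ q (by omega), fin_snoc_mk_self z p, fin_snoc_mk_self _ q]
end

section
/- For every n ≥ 6 and every c = (c_0,…,c_{n−1}) ∈ F_2^n with c_{n−1} = 0, f̂_2^n(c) = 2·( f̂_0^{n−2}(c^{n−2}) + (−1)^{c_{n−3}+c_{n−2}} · f̂_2^{n−3}(c^{n−3} + e_{2^{n−4}}) ), where c^m denotes the vector of the first m coordinates of c and e_{2^{n−4}} = (0,…,0,1) ∈ F_2^{n−3}. -/
theorem sum_fin_succ_eq_sum_snoc {M : Type*} [AddCommMonoid M] (k : ℕ)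
    (F : (Fin (k + 1) → ZMod 2) → M) :
    ∑ x, F x = ∑ x : Fin k → ZMod 2, ∑ b : ZMod 2, F (Fin.snoc (α := fun _ => ZMod 2) x b) := by
  rw [← (Fin.snocEquiv fun _ : Fin (k + 1) => ZMod 2).sum_comp F, Fintype.sum_prod_type,
    Finset.sum_comm]
  rfl

theorem snoc_mk_of_lt {k : ℕ} (x : Fin k → ZMod 2) (b : ZMod 2) (i : ℕ) (h : i < k)
    (h' : i < k + 1) : Fin.snoc (α := fun _ => ZMod 2) x b ⟨i, h'⟩ = x ⟨i, h⟩ :=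
  Fin.snoc_castSucc (α := fun _ => ZMod 2) b x ⟨i, h⟩

theorem snoc_mk_self {k : ℕ} (x : Fin k → ZMod 2) (b : ZMod 2) (h : k < k + 1) :
    Fin.snoc (α := fun _ => ZMod 2) x b ⟨k, h⟩ = b :=
  Fin.snoc_last (α := fun _ => ZMod 2) b x

theorem dotp_snoc_s8 (k : ℕ) (c : Fin (k + 1) → ZMod 2) (x : Fin k → ZMod 2) (b : ZMod 2) :
    dotp (k + 1) c (Fin.snoc (α := fun _ => ZMod 2) x b)
      = dotp k (trunc k (Nat.le_succ k) c) x + c ⟨k, Nat.lt_succ_self k⟩ * b := by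
  simp only [dotp, Fin.sum_univ_castSucc, Fin.snoc_castSucc, Fin.snoc_last]
  rfl

theorem tm_snoc_s8 (k : ℕ) (x : Fin (k + 2) → ZMod 2) (b : ZMod 2) :
    tm (k + 3) (Fin.snoc (α := fun _ => ZMod 2) x b)
      = tm (k + 2) x + x ⟨k, by omega⟩ * x ⟨k + 1, by omega⟩ * b := by
  unfold tm
  rw [Finset.sum_range_succ, Finset.sum_range_succ, Finset.sum_range_succ,
    Finset.sum_range_succ (n := k + 1), Finset.sum_range_succ (n := k),
    dif_neg (show ¬k + 2 + 2 < k + 3 by omega), dif_neg (show ¬k + 1 + 2 < k + 3 by omega),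
    dif_pos (show k + 2 < k + 3 by omega), dif_neg (show ¬k + 1 + 2 < k + 2 by omega),
    dif_neg (show ¬k + 2 < k + 2 by omega), snoc_mk_of_lt x b k (by omega),
    snoc_mk_of_lt x b (k + 1) (by omega),
    snoc_mk_self x b]
  simp only [add_zero]
  congr 1
  refine Finset.sum_congr rfl fun i hi => ?_
  have hi := Finset.mem_range.mp hi
  rw [dif_pos (by omega), dif_pos (by omega), snoc_mk_of_lt x b i (by omega),
    snoc_mk_of_lt x b (i + 1) (by omega), snoc_mk_of_lt x b (i + 2) (by omega)]

theorem dotp_add_eLast (k : ℕ) (c x : Fin (k + 1) → ZMod 2) :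
    dotp (k + 1) (c + eLast (k + 1)) x = dotp (k + 1) c x + x ⟨k, Nat.lt_succ_self k⟩ := by
  simp only [dotp, Pi.add_apply, add_mul, Finset.sum_add_distrib]
  congr 1
  rw [Finset.sum_eq_single ⟨k, Nat.lt_succ_self k⟩]
  · simp [eLast]
  · intro i _ hi
    have hik : (i : ℕ) ≠ k := fun h => hi (Fin.ext h)
    simp [eLast, hik]
  · simp

theorem f2_add_two (k : ℕ) (x : Fin (k + 2) → ZMod 2) :
    f2 (k + 2) x = tm (k + 2) x + x ⟨k, by omega⟩ * x ⟨k + 1, by omega⟩ :=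
  dif_pos (by omega)

/-- Summing over the last three variables: here `t`, `l` are the cubic and linear parts in the
remaining variables, `a`, `b` the last two of these, and `d`, `e` the Fourier coefficients. -/
theorem sum_last_three (t l a b d e : ZMod 2) :
    ∑ w : ZMod 2, ∑ y : ZMod 2, ∑ z : ZMod 2,
        (-1 : ℤ) ^ (t + a * b * w + b * w * y + w * y * z + y * z
          + (l + d * w + e * y + 0 * z)).val
      = 2 * (∑ w : ZMod 2, (-1 : ℤ) ^ (t + a * b * w + (l + d * w)).val
          + (-1 : ℤ) ^ (d + e).val * (-1 : ℤ) ^ (t + a * b + (l + b)).val) := by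
  revert t l a b d e
  decide

/-- For every `n ≥ 6` and `c ∈ F_2^n` with `c_{n−1} = 0`,
`f̂_2^n(c) = 2(f̂_0^{n−2}(c^{n−2}) + (−1)^{c_{n−3}+c_{n−2}} f̂_2^{n−3}(c^{n−3} + e_{2^{n−4}}))`. -/
theorem stmt_8 (n : ℕ) (hn : 6 ≤ n) (c : Fin n → ZMod 2)
    (hc : c ⟨n - 1, by omega⟩ = 0) :
    walsh n (f2 n) c
      = 2 * (walsh (n - 2) (f0 (n - 2)) (trunc (n - 2) (by omega) c)
          + (-1 : ℤ) ^ (c ⟨n - 3, by omega⟩ + c ⟨n - 2, by omega⟩).val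
              * walsh (n - 3) (f2 (n - 3))
                  (trunc (n - 3) (by omega) c + eLast (n - 3))) := by
  obtain ⟨k, rfl⟩ : ∃ k, n = k + 5 := ⟨n - 5, by omega⟩
  change c ⟨k + 4, _⟩ = 0 at hc
  change walsh (k + 5) (f2 (k + 5)) c
      = 2 * (walsh (k + 3) (f0 (k + 3)) (trunc (k + 3) (by omega) c)
          + (-1 : ℤ) ^ (c ⟨k + 2, by omega⟩ + c ⟨k + 3, by omega⟩).val
              * walsh (k + 2) (f2 (k + 2)) (trunc (k + 2) (by omega) c + eLast (k + 2)))
  unfold walsh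
  simp only [sum_fin_succ_eq_sum_snoc (k + 4), sum_fin_succ_eq_sum_snoc (k + 3),
    sum_fin_succ_eq_sum_snoc (k + 2)]
  rw [Finset.mul_sum, ← Finset.sum_add_distrib, Finset.mul_sum]
  refine Finset.sum_congr rfl fun x _ => ?_
  have h := sum_last_three (tm (k + 2) x) (dotp (k + 2) (trunc (k + 2) (by omega) c) x)
    (x ⟨k, by omega⟩) (x ⟨k + 1, by omega⟩) (c ⟨k + 2, by omega⟩) (c ⟨k + 3, by omega⟩)
  convert h using 1
  · refine Finset.sum_congr rfl fun w _ => Finset.sum_congr rfl fun y _ =>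
      Finset.sum_congr rfl fun z _ => ?_
    rw [f2_add_two (k + 3), tm_snoc_s8 (k + 2), tm_snoc_s8 (k + 1), tm_snoc_s8 k, dotp_snoc_s8, dotp_snoc_s8,
      dotp_snoc_s8, hc]
    simp only [snoc_mk_self, snoc_mk_of_lt _ _ (k + 3) (Nat.lt_succ_self _),
      snoc_mk_of_lt _ _ (k + 2) (Nat.lt_succ_self _), snoc_mk_of_lt _ _ (k + 1) (Nat.lt_succ_self _)]
    rfl
  · simp only [f0, f2_add_two, tm_snoc_s8, dotp_snoc_s8, dotp_add_eLast]
    rfl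
end

section
/- For every n ≥ 6, F̂_3^n(0) = 2·( F̂_3^{n−2}(0) + F̂_3^{n−3}(0) ), where 0 denotes the zero vector of the appropriate dimension; equivalently, wt(F_3^n) = 2·( wt(F_3^{n−2}) + wt(F_3^{n−3}) ) + 2^{n−3}. -/
/-- The sign character `a ↦ (-1)^a` of `F_2`. -/
def signChar (a : ZMod 2) : ℤ := (-1) ^ a.val

theorem signChar_add (a b : ZMod 2) : signChar (a + b) = signChar a * signChar b := by
  revert a b; decide

theorem signChar_sum {ι : Type*} (s : Finset ι) (f : ι → ZMod 2) :
    signChar (∑ i ∈ s, f i) = ∏ i ∈ s, signChar (f i) := by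
  classical
  induction s using Finset.induction_on with
  | empty => simp [signChar]
  | insert i s hi ih => rw [Finset.sum_insert hi, Finset.prod_insert hi, signChar_add, ih]

theorem signChar_eq_ite (a : ZMod 2) : signChar a = 1 - 2 * (if a = 1 then 1 else 0) := by
  revert a; decide

/-- Transfer matrix of the cubic form `Σ x_i x_{i+1} x_{i+2}`, indexed by pairs of consecutive
coordinates. -/
def transferMatrix : Matrix (ZMod 2 × ZMod 2) (ZMod 2 × ZMod 2) ℤ :=
  fun p q => if p.2 = q.1 then signChar (p.1 * p.2 * q.2) else 0

theorem transferMatrix_sq_apply (a b c d : ZMod 2) :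
    (transferMatrix ^ 2) (a, b) (c, d) = signChar (a * b * c) * signChar (b * c * d) := by
  simp only [pow_two, Matrix.mul_apply]
  revert a b c d; decide

theorem transferMatrix_mul_apply (A : Matrix (ZMod 2 × ZMod 2) (ZMod 2 × ZMod 2) ℤ)
    (a b : ZMod 2) (q : ZMod 2 × ZMod 2) :
    (transferMatrix * A) (a, b) q = ∑ e, signChar (a * b * e) * A (b, e) q := by
  simp only [Matrix.mul_apply, Fintype.sum_prod_type, transferMatrix, ite_mul, zero_mul]
  rw [Finset.sum_eq_single b]
  · simp
  · intro x _ hx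
    simp [hx.symm]
  · simp

theorem transferMatrix_pow_four :
    transferMatrix ^ 4 = 2 • (transferMatrix ^ 2 + transferMatrix) := by
  have h : ∀ p q, (transferMatrix ^ 4) p q = (2 • (transferMatrix ^ 2 + transferMatrix)) p q := by
    rintro ⟨a, b⟩ ⟨c, d⟩
    rw [show transferMatrix ^ 4 = transferMatrix * (transferMatrix * transferMatrix ^ 2) by
      simp only [← pow_succ']]
    simp only [transferMatrix_mul_apply, Matrix.smul_apply, Matrix.add_apply,
      transferMatrix_sq_apply]
    revert a b c d; decide
  exact Matrix.ext h

/-- The sequence `a, b, y_0, …, y_{m-1}, c, d, d, …`. -/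
def framedSeq (m : ℕ) (a b : ZMod 2) (y : Fin m → ZMod 2) (c d : ZMod 2) : ℕ → ZMod 2
  | 0 => a
  | 1 => b
  | i + 2 => if h : i < m then y ⟨i, h⟩ else if i = m then c else d

theorem framedSeq_cons_succ (m : ℕ) (a b e : ZMod 2) (y : Fin m → ZMod 2) (c d : ZMod 2) (i : ℕ) :
    framedSeq (m + 1) a b (Fin.cons e y) c d (i + 1) = framedSeq m b e y c d i := by
  rcases i with _ | _ | i
  · rfl
  · simp only [framedSeq]
    rw [dif_pos (by omega)]
    rfl
  · simp only [framedSeq]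
    by_cases h : i < m
    · rw [dif_pos h, dif_pos (by omega)]
      rfl
    · rw [dif_neg h, dif_neg (by omega)]
      simp

theorem sum_fin_succ_arrow (m : ℕ) (f : (Fin (m + 1) → ZMod 2) → ℤ) :
    ∑ x, f x = ∑ a, ∑ y : Fin m → ZMod 2, f (Fin.cons a y) := by
  rw [← (Fin.consEquiv fun _ : Fin (m + 1) => ZMod 2).sum_comp, Fintype.sum_prod_type]
  rfl

theorem transferMatrix_pow_apply (m : ℕ) (a b c d : ZMod 2) :
    (transferMatrix ^ (m + 2)) (a, b) (c, d) = ∑ y : Fin m → ZMod 2, ∏ i : Fin (m + 2),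
      signChar (framedSeq m a b y c d i * framedSeq m a b y c d (i + 1)
        * framedSeq m a b y c d (i + 2)) := by
  induction m generalizing a b with
  | zero =>
    rw [transferMatrix_sq_apply]
    simp [Fin.prod_univ_two, framedSeq]
  | succ m ih =>
    rw [show m + 1 + 2 = m + 2 + 1 by ring, pow_succ', transferMatrix_mul_apply,
      sum_fin_succ_arrow]
    refine Finset.sum_congr rfl fun e _ => ?_
    rw [ih, Finset.mul_sum]
    refine Finset.sum_congr rfl fun y _ => ?_
    rw [Fin.prod_univ_succ (n := m + 2)]
    refine congrArg₂ (· * ·) rfl (Finset.prod_congr rfl fun i _ => ?_)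
    simp only [Fin.val_succ, add_right_comm _ 1 2, framedSeq_cons_succ]

theorem framedSeq_eq_mod (m : ℕ) (a b : ZMod 2) (y : Fin m → ZMod 2) (i : ℕ) (hi : i < m + 4) :
    framedSeq m a b y a b i =
      (Fin.cons a (Fin.cons b y : Fin (m + 1) → ZMod 2) : Fin (m + 2) → ZMod 2)
        ⟨i % (m + 2), Nat.mod_lt _ (by omega)⟩ := by
  have small : ∀ j (h : j < m + 2), framedSeq m a b y a b j =
      (Fin.cons a (Fin.cons b y : Fin (m + 1) → ZMod 2) : Fin (m + 2) → ZMod 2) ⟨j, h⟩ := by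
    intro j h
    rcases j with _ | _ | j
    · rfl
    · rfl
    · simp only [framedSeq]
      rw [dif_pos (by omega)]
      rfl
  by_cases h : i < m + 2
  · simp only [Nat.mod_eq_of_lt h, small i h]
  · have hmod : i % (m + 2) = i - (m + 2) := by
      rw [Nat.mod_eq_sub_mod (by omega), Nat.mod_eq_of_lt (by omega)]
    simp only [hmod]
    rw [← small (i - (m + 2)) (by omega)]
    obtain rfl | rfl : i = m + 2 ∨ i = m + 3 := by omega
    · simp [framedSeq]
    · rw [show m + 3 - (m + 2) = 1 by omega, show m + 3 = m + 1 + 2 by ring]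
      simp [framedSeq]

theorem walsh_zero (n : ℕ) (f : (Fin n → ZMod 2) → ZMod 2) :
    walsh n f 0 = ∑ x, signChar (f x) := by
  simp [walsh, dotp, signChar]

theorem walsh_F3_eq_trace (n : ℕ) (hn : 2 ≤ n) :
    walsh n (F3 n) 0 = (transferMatrix ^ n).trace := by
  obtain ⟨m, rfl⟩ := Nat.exists_eq_add_of_le' hn
  rw [walsh_zero, sum_fin_succ_arrow, Matrix.trace, Fintype.sum_prod_type]
  refine Finset.sum_congr rfl fun a _ => ?_
  rw [sum_fin_succ_arrow]
  refine Finset.sum_congr rfl fun b _ => ?_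
  rw [Matrix.diag_apply, transferMatrix_pow_apply]
  refine Finset.sum_congr rfl fun y _ => ?_
  rw [F3, signChar_sum]
  refine Finset.prod_congr rfl fun i _ => ?_
  rw [framedSeq_eq_mod m a b y i (by omega), framedSeq_eq_mod m a b y (i + 1) (by omega),
    framedSeq_eq_mod m a b y (i + 2) (by omega)]
  simp only [Nat.mod_eq_of_lt i.isLt]

theorem walsh_zero_eq_sub_wt (n : ℕ) (f : (Fin n → ZMod 2) → ZMod 2) :
    walsh n f 0 = 2 ^ n - 2 * (wt n f : ℤ) := by
  simp only [walsh_zero, signChar_eq_ite, wt, Finset.sum_sub_distrib, ← Finset.mul_sum,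
    Finset.sum_boole]
  simp

/-- For every `n ≥ 6`,
`F̂_3^n(0) = 2(F̂_3^{n−2}(0) + F̂_3^{n−3}(0))`; equivalently
`wt(F_3^n) = 2(wt(F_3^{n−2}) + wt(F_3^{n−3})) + 2^{n−3}`. -/
theorem stmt_14 (n : ℕ) (hn : 6 ≤ n) :
    walsh n (F3 n) 0
        = 2 * (walsh (n - 2) (F3 (n - 2)) 0 + walsh (n - 3) (F3 (n - 3)) 0)
    ∧ wt n (F3 n) = 2 * (wt (n - 2) (F3 (n - 2)) + wt (n - 3) (F3 (n - 3))) + 2 ^ (n - 3) := by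
  have walsh_rec : walsh n (F3 n) 0
      = 2 * (walsh (n - 2) (F3 (n - 2)) 0 + walsh (n - 3) (F3 (n - 3)) 0) := by
    rw [walsh_F3_eq_trace n (by omega), walsh_F3_eq_trace (n - 2) (by omega),
      walsh_F3_eq_trace (n - 3) (by omega)]
    obtain ⟨k, rfl⟩ := Nat.exists_eq_add_of_le' (show 4 ≤ n by omega)
    rw [show k + 4 - 2 = k + 2 by omega, show k + 4 - 3 = k + 1 by omega, pow_add,
      transferMatrix_pow_four, mul_smul_comm, mul_add, ← pow_add, ← pow_succ,
      Matrix.trace_smul, Matrix.trace_add]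
    simp
  refine ⟨walsh_rec, ?_⟩
  simp only [walsh_zero_eq_sub_wt] at walsh_rec
  obtain ⟨k, rfl⟩ := Nat.exists_eq_add_of_le' (show 3 ≤ n by omega)
  simp only [show k + 3 - 2 = k + 1 by omega, Nat.add_sub_cancel, pow_succ] at walsh_rec ⊢
  zify
  linarith
end

section
/- For every n ≥ 7, F̂_3^{n−1}(0) ≤ F̂_3^n(0) ≤ 2·F̂_3^{n−1}(0), where 0 denotes the zero vector of the appropriate dimension. -/
/-- The sum of the products of three consecutive terms of the sequence `a, b, z_0, …, z_{m-1}, u, v`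
over `F_2`. -/
def openCubic : (m : ℕ) → (a b u v : ZMod 2) → (Fin m → ZMod 2) → ZMod 2
  | 0, a, b, u, v, _ => a * b * u + b * u * v
  | m + 1, a, b, u, v, z => a * b * z 0 + openCubic m b (z 0) u v (Fin.tail z)

/-- The character sum of `openCubic` over the inner terms, with the four end terms fixed. -/
def openSum (m : ℕ) (a b u v : ZMod 2) : ℤ :=
  ∑ z : Fin m → ZMod 2, (-1 : ℤ) ^ (openCubic m a b u v z).val

theorem neg_one_pow_val_add (a b : ZMod 2) :
    (-1 : ℤ) ^ (a + b).val = (-1) ^ a.val * (-1) ^ b.val := by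
  revert a b; decide

theorem sum_zmod_two (f : ZMod 2 → ℤ) : ∑ a, f a = f 0 + f 1 := Fin.sum_univ_two f

theorem sum_fin_succ_fun (m : ℕ) (f : (Fin (m + 1) → ZMod 2) → ℤ) :
    ∑ x, f x = ∑ a, ∑ z : Fin m → ZMod 2, f (Fin.cons a z) := by
  rw [← (Fin.consEquiv fun _ : Fin (m + 1) => ZMod 2).sum_comp, Fintype.sum_prod_type]
  rfl

theorem openCubic_eq_sum_range (m : ℕ) (a b u v : ZMod 2) (z : Fin m → ZMod 2) (g : ℕ → ZMod 2)
    (h0 : g 0 = a) (h1 : g 1 = b) (hz : ∀ i : Fin m, g (i + 2) = z i)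
    (hu : g (m + 2) = u) (hv : g (m + 3) = v) :
    openCubic m a b u v z = ∑ i ∈ Finset.range (m + 2), g i * g (i + 1) * g (i + 2) := by
  induction m generalizing a b g with
  | zero => simp [openCubic, Finset.sum_range_succ, ← h0, ← h1, ← hu, ← hv]
  | succ m ih =>
    rw [Finset.sum_range_succ', openCubic,
      ih b (z 0) (Fin.tail z) (fun i => g (i + 1)) h1 (hz 0) (fun i => hz i.succ) hu hv, add_comm,
      h0, h1, ← hz 0]
    rfl

theorem F3_cons_cons (m : ℕ) (a b : ZMod 2) (z : Fin m → ZMod 2) :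
    F3 (m + 2) (Fin.cons a (Fin.cons b z : Fin (m + 1) → ZMod 2)) = openCubic m a b a b z := by
  set x : Fin (m + 2) → ZMod 2 := Fin.cons a (Fin.cons b z : Fin (m + 1) → ZMod 2)
  have hx0 : ∀ h, x ⟨0, h⟩ = a := fun _ => rfl
  have hx1 : ∀ h, x ⟨1, h⟩ = b := fun _ => rfl
  have hxz : ∀ (i : Fin m) (h), x ⟨i + 2, h⟩ = z i := fun _ _ => rfl
  rw [openCubic_eq_sum_range m a b a b z
    (fun i => x ⟨i % (m + 2), Nat.mod_lt _ (Nat.succ_pos _)⟩), F3, Finset.sum_range]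
  · refine Finset.sum_congr rfl fun i _ => ?_
    simp only [Nat.mod_eq_of_lt i.isLt]
  · simp only [Nat.zero_mod, hx0]
  · simp only [Nat.mod_eq_of_lt (show 1 < m + 2 by omega), hx1]
  · intro i
    simp only [Nat.mod_eq_of_lt (show (i : ℕ) + 2 < m + 2 by omega), hxz]
  · simp only [Nat.mod_self, hx0]
  · simp only [show (m + 3) % (m + 2) = 1 by
      rw [show m + 3 = 1 + (m + 2) by omega, Nat.add_mod_right, Nat.mod_eq_of_lt (by omega)], hx1]

theorem walsh_F3_zero_eq_sum_openSum (m : ℕ) :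
    walsh (m + 2) (F3 (m + 2)) 0 = ∑ a, ∑ b, openSum m a b a b := by
  simp only [walsh, dotp, Pi.zero_apply, zero_mul, Finset.sum_const_zero, add_zero,
    sum_fin_succ_fun, F3_cons_cons, openSum]

theorem openSum_succ (m : ℕ) (a b u v : ZMod 2) :
    openSum (m + 1) a b u v = ∑ c, (-1 : ℤ) ^ (a * b * c).val * openSum m b c u v := by
  simp only [openSum, sum_fin_succ_fun, openCubic, Fin.cons_zero, Fin.tail_cons,
    neg_one_pow_val_add, Finset.mul_sum]

theorem openSum_add_four (m : ℕ) (a b u v : ZMod 2) :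
    openSum (m + 4) a b u v = 2 * openSum (m + 2) a b u v + 2 * openSum (m + 1) a b u v := by
  have h2 : ∀ x : ZMod 2, x = 0 ∨ x = 1 := by decide
  rcases h2 a with rfl | rfl <;> rcases h2 b with rfl | rfl <;>
    simp [openSum_succ, sum_zmod_two, ZMod.val_one] <;> ring

theorem walsh_F3_zero_recurrence (m : ℕ) :
    walsh (m + 6) (F3 (m + 6)) 0 =
      2 * walsh (m + 4) (F3 (m + 4)) 0 + 2 * walsh (m + 3) (F3 (m + 3)) 0 := by
  rw [walsh_F3_zero_eq_sum_openSum (m + 4), walsh_F3_zero_eq_sum_openSum (m + 2),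
    walsh_F3_zero_eq_sum_openSum (m + 1)]
  simp only [openSum_add_four, Finset.sum_add_distrib, Finset.mul_sum]

theorem walsh_F3_zero_three_four_five :
    walsh 3 (F3 3) 0 = 6 ∧ walsh 4 (F3 4) 0 = 8 ∧ walsh 5 (F3 5) 0 = 20 := by
  rw [walsh_F3_zero_eq_sum_openSum 1, walsh_F3_zero_eq_sum_openSum 2,
    walsh_F3_zero_eq_sum_openSum 3]
  have h0 (a b u v : ZMod 2) : openSum 0 a b u v = (-1) ^ (a * b * u + b * u * v).val := by
    simp [openSum, openCubic]
  simp only [openSum_succ, h0]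
  decide

theorem le_and_le_two_mul_of_recurrence (s : ℕ → ℤ)
    (hs : ∀ m, s (m + 3) = 2 * s (m + 1) + 2 * s m) (h0 : s 0 = 6) (h1 : s 1 = 8) (h2 : s 2 = 20)
    (m : ℕ) : s (m + 3) ≤ s (m + 4) ∧ s (m + 4) ≤ 2 * s (m + 3) := by
  induction m using Nat.strong_induction_on with
  | _ m ih =>
    have h3 : s 3 = 28 := by rw [hs 0, h0, h1]; rfl
    have h4 : s 4 = 56 := by rw [hs 1, h1, h2]; rfl
    have h5 : s 5 = 96 := by rw [hs 2, h2, h3]; rfl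
    have h6 : s 6 = 168 := by rw [hs 3, h3, h4]; rfl
    match m with
    | 0 => simp [h3, h4]
    | 1 => simp [h4, h5]
    | 2 => simp [h5, h6]
    | k + 3 =>
      have i := ih k (by omega)
      have i' := ih (k + 1) (by omega)
      rw [hs (k + 3), hs (k + 3 + 1)]
      constructor <;> linarith

/-- For every `n ≥ 7`, `F̂_3^{n−1}(0) ≤ F̂_3^n(0) ≤ 2 F̂_3^{n−1}(0)`. -/
theorem stmt_16 (n : ℕ) (hn : 7 ≤ n) :
    walsh (n - 1) (F3 (n - 1)) 0 ≤ walsh n (F3 n) 0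
      ∧ walsh n (F3 n) 0 ≤ 2 * walsh (n - 1) (F3 (n - 1)) 0 := by
  obtain ⟨m, rfl⟩ := Nat.exists_eq_add_of_le' hn
  obtain ⟨h3, h4, h5⟩ := walsh_F3_zero_three_four_five
  exact le_and_le_two_mul_of_recurrence (fun m => walsh (m + 3) (F3 (m + 3)) 0)
    walsh_F3_zero_recurrence h3 h4 h5 m
end
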